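/- Let $G$ be a $6$-double-critical graph that is claw-free, and assume $G$ is not isomorphic to $K_6$. If $xy \in E(G)$ and $|N(x) \cap N(y)| = 5$, then the subgraph of $G$ induced by $N(x) \cap N(y)$ is isomorphic to the cycle $C_5$ on five vertices. -/

import Mathlib

open SimpleGraph

/-- A connected graph `G` with chromatic number `n` is `n`-double-critical if
deleting the two endpoints of any edge drops the chromatic number to `n - 2`. -/
def DoubleCritical {V : Type*} (G : SimpleGraph V) (n : ℕ) : Prop :=
  G.Connected ∧ G.chromaticNumber = (n : ℕ∞) ∧
    ∀ x y : V, G.Adj x y →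
      (G.induce ({x, y}ᶜ : Set V)).chromaticNumber = ((n - 2 : ℕ) : ℕ∞)

/-- A graph is claw-free if it has no induced `K_{1,3}`. -/
def ClawFree {V : Type*} (G : SimpleGraph V) : Prop :=
  ∀ v a b c : V, G.Adj v a → G.Adj v b → G.Adj v c →
    a ≠ b → a ≠ c → b ≠ c → ¬ G.Adj a b → ¬ G.Adj a c → ¬ G.Adj b c → False

/-- A graph on five vertices without a triangle and without three pairwise nonadjacent vertices
is a 5-cycle. -/
theorem nonempty_iso_cycleGraph_five {W : Type*} [Fintype W] (H : SimpleGraph W)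
    (hW : Fintype.card W = 5)
    (htri : ∀ a b c, H.Adj a b → H.Adj a c → ¬ H.Adj b c)
    (hind : ∀ a b c, a ≠ b → a ≠ c → b ≠ c → ¬ H.Adj a b → ¬ H.Adj a c → H.Adj b c) :
    Nonempty (H ≃g cycleGraph 5) := by
  classical
  suffices h : ∃ p a c d b : W, [p, a, c, d, b].Nodup ∧ H.Adj p a ∧ H.Adj a c ∧ H.Adj c d ∧
      H.Adj d b ∧ H.Adj b p ∧ ¬ H.Adj p c ∧ ¬ H.Adj p d ∧ ¬ H.Adj a d ∧ ¬ H.Adj a b ∧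
      ¬ H.Adj c b by
    obtain ⟨p, a, c, d, b, hnd, h1, h2, h3, h4, h5, h6, h7, h8, h9, h10⟩ := h
    have hinj : Function.Injective ![p, a, c, d, b] := by
      have := List.nodup_iff_injective_get.mp hnd
      intro i j hij
      refine this (a₁ := i) (a₂ := j) ?_
      fin_cases i <;> fin_cases j <;> exact hij
    have hbij : Function.Bijective ![p, a, c, d, b] :=
      (Fintype.bijective_iff_injective_and_card _).mpr ⟨hinj, by simp [hW]⟩
    refine ⟨RelIso.symm ⟨Equiv.ofBijective _ hbij, ?_⟩⟩
    intro i j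
    fin_cases i <;> fin_cases j <;>
      simp [cycleGraph_adj, h1, h2, h3, h4, h5, h6, h7, h8, h9, h10, h1.symm, h2.symm, h3.symm,
        h4.symm, h5.symm, H.adj_comm c p, H.adj_comm d p, H.adj_comm d a, H.adj_comm b a,
        H.adj_comm b c] <;> decide
  have : Nonempty W := Fintype.card_pos_iff.mp (by omega)
  obtain ⟨p⟩ := this
  set N : Finset W := {v | H.Adj p v} with hN
  set M : Finset W := {v | v ≠ p ∧ ¬ H.Adj p v} with hM
  have hsum : N.card + M.card = 4 := by
    have h : N ∪ M = Finset.univ.erase p := by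
      ext v
      have := H.loopless.irrefl p
      simp only [hN, hM, Finset.mem_union, Finset.mem_filter, Finset.mem_univ, true_and,
        Finset.mem_erase, and_true]
      grind
    have hd : Disjoint N M := by
      rw [Finset.disjoint_left]
      simp +contextual [hN, hM]
    rw [← Finset.card_union_of_disjoint hd, h, Finset.card_erase_of_mem (Finset.mem_univ p),
      Finset.card_univ, hW]
  have hN2 : N.card ≤ 2 := by
    by_contra! h
    obtain ⟨a, b, c, ha, hb, hc, hab, hac, hbc⟩ := Finset.two_lt_card_iff.mp h
    simp only [hN, Finset.mem_filter, Finset.mem_univ, true_and] at ha hb hc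
    exact htri p b c hb hc (hind a b c hab hac hbc (htri p a b ha hb) (htri p a c ha hc))
  have hM2 : M.card ≤ 2 := by
    by_contra! h
    obtain ⟨a, b, c, ha, hb, hc, hab, hac, hbc⟩ := Finset.two_lt_card_iff.mp h
    simp only [hM, Finset.mem_filter, Finset.mem_univ, true_and] at ha hb hc
    exact htri a b c (hind p a b ha.1.symm hb.1.symm hab ha.2 hb.2)
      (hind p a c ha.1.symm hc.1.symm hac ha.2 hc.2)
      (hind p b c hb.1.symm hc.1.symm hbc hb.2 hc.2)
  obtain ⟨a, b, hab, hNab⟩ := Finset.card_eq_two.mp (show N.card = 2 by omega)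
  obtain ⟨c, d, hcd, hMcd⟩ := Finset.card_eq_two.mp (show M.card = 2 by omega)
  have ha : H.Adj p a := by simpa [hN] using (hNab ▸ by simp : a ∈ N)
  have hb : H.Adj p b := by simpa [hN] using (hNab ▸ by simp : b ∈ N)
  have hc : c ≠ p ∧ ¬ H.Adj p c := by simpa [hM] using (hMcd ▸ by simp : c ∈ M)
  have hd : d ≠ p ∧ ¬ H.Adj p d := by simpa [hM] using (hMcd ▸ by simp : d ∈ M)
  have hAdjcd := hind p c d hc.1.symm hd.1.symm hcd hc.2 hd.2
  have hnab := htri p a b ha hb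
  have hac : a ≠ c := by rintro rfl; exact hc.2 ha
  have had : a ≠ d := by rintro rfl; exact hd.2 ha
  have hbc : b ≠ c := by rintro rfl; exact hc.2 hb
  have hbd : b ≠ d := by rintro rfl; exact hd.2 hb
  have hacd := htri c a d
  have hbcd := htri c b d
  have habc := hind a b c hab hac hbc hnab
  have habd := hind a b d hab had hbd hnab
  have hpa := ha.ne
  have hpb := hb.ne
  by_cases h : H.Adj a c
  · refine ⟨p, a, c, d, b, ?_, ?_⟩
    · simp; grind
    · grind [H.adj_comm]
  · refine ⟨p, a, d, c, b, ?_, ?_⟩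
    · simp; grind
    · grind [H.adj_comm]

/-- Deleting the ends of an edge disjoint from a clique keeps the clique, so the clique has at
most `n - 2` vertices. -/
theorem DoubleCritical.card_le_of_isClique {V : Type*} {G : SimpleGraph V} {n : ℕ}
    (h : DoubleCritical G n) {K : Finset V} (hK : G.IsClique K) {u v : V} (huv : G.Adj u v)
    (hu : u ∉ K) (hv : v ∉ K) : K.card ≤ n - 2 := by
  obtain ⟨C⟩ := chromaticNumber_le_iff_colorable.mp (h.2.2 u v huv).le
  have hmem (k : K) : k.1 ∈ ({u, v}ᶜ : Set V) := by
    have := k.2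
    simp only [Set.mem_compl_iff, Set.mem_insert_iff, Set.mem_singleton_iff]
    grind
  have hinj : Function.Injective fun k : K => C ⟨k.1, hmem k⟩ := by
    intro k l hkl
    by_contra hne
    refine C.valid (v := ⟨k.1, hmem k⟩) (w := ⟨l.1, hmem l⟩) ?_ hkl
    exact hK k.2 l.2 (fun h => hne (Subtype.ext h))
  simpa using Fintype.card_le_of_injective _ hinj

/-- A double-critical `n`-chromatic graph with a clique of size `n` is complete. -/
theorem DoubleCritical.nonempty_iso_top_of_isNClique {V : Type*} {G : SimpleGraph V} {n : ℕ}
    (hn : 2 ≤ n) (h : DoubleCritical G n) {Q : Finset V} (hQ : G.IsNClique n Q) :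
    Nonempty (G ≃g (⊤ : SimpleGraph (Fin n))) := by
  classical
  have huniv : ∀ v, v ∈ Q := by
    by_contra! hex
    obtain ⟨z, hz⟩ := hex
    obtain ⟨q, hq⟩ := Finset.card_pos.mp (by rw [hQ.card_eq]; omega : 0 < Q.card)
    obtain ⟨p⟩ := h.1.preconnected q z
    obtain ⟨d, -, hd1, hd2⟩ := p.exists_boundary_dart (Q : Set V) hq hz
    have hle := h.card_le_of_isClique (K := Q.erase d.fst)
      (hQ.isClique.subset (by simp)) d.adj (by simp)
      (fun hmem => hd2 (Finset.mem_of_mem_erase hmem))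
    rw [Finset.card_erase_of_mem hd1, hQ.card_eq] at hle
    omega
  let e : V ≃ Fin n := (Equiv.subtypeUnivEquiv huniv).symm.trans (Q.equivFinOfCardEq hQ.card_eq)
  refine ⟨⟨e, ?_⟩⟩
  intro a b
  simp only [top_adj, ne_eq, EmbeddingLike.apply_eq_iff_eq]
  exact ⟨fun hab => hQ.isClique (huniv a) (huniv b) hab, fun hab => hab.ne⟩

/-- A double-critical `n`-chromatic graph with a clique of size `n - 1` is complete. -/
theorem DoubleCritical.nonempty_iso_top_of_isNClique_pred {V : Type*} {G : SimpleGraph V} {n : ℕ}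
    (hn : 2 ≤ n) (h : DoubleCritical G n) {K : Finset V} (hK : G.IsNClique (n - 1) K) :
    Nonempty (G ≃g (⊤ : SimpleGraph (Fin n))) := by
  classical
  have hedge : ∀ u v, G.Adj u v → u ∉ K → v ∈ K := by
    intro u v huv hu
    by_contra hv
    have := h.card_le_of_isClique hK.isClique huv hu hv
    rw [hK.card_eq] at this
    omega
  suffices hz : ∃ z, ∀ k ∈ K, G.Adj z k by
    obtain ⟨z, hz⟩ := hz
    have hQ := hK.insert hz
    rw [Nat.sub_add_cancel (by omega : 1 ≤ n)] at hQ
    exact h.nonempty_iso_top_of_isNClique hn hQ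
  by_contra! hmiss
  choose f hfK hf using hmiss
  let C : G.Coloring K := Coloring.mk
    (fun v => if hv : v ∈ K then ⟨v, hv⟩ else ⟨f v, hfK v⟩) (by
      intro u v huv
      have h1 := hedge u v huv
      have h2 := hedge v u huv.symm
      have h3 := hf u
      have h4 := hf v
      have h5 := huv.ne
      have h6 := huv.symm
      split_ifs <;> simp only [ne_eq, Subtype.mk.injEq] <;> grind)
  have hle := C.colorable.chromaticNumber_le
  rw [h.2.1, Fintype.card_coe, hK.card_eq, Nat.cast_le] at hle
  omega

/-- In a claw-free 6-double-critical graph not isomorphic to $K_6$, if two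
adjacent vertices have exactly 5 common neighbors, then these common neighbors
induce a 5-cycle. -/
theorem stmt_6 {V : Type*} [Fintype V] (G : SimpleGraph V)
    (hdc : DoubleCritical G 6) (hcf : ClawFree G)
    (hniso : ¬ Nonempty (G ≃g (⊤ : SimpleGraph (Fin 6))))
    (x y : V) (hxy : G.Adj x y)
    (hcard : (G.neighborSet x ∩ G.neighborSet y).ncard = 5) :
    Nonempty ((G.induce (G.neighborSet x ∩ G.neighborSet y)) ≃g cycleGraph 5) := by
  classical
  have hW : Fintype.card ↥(G.neighborSet x ∩ G.neighborSet y) = 5 := by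
    rw [← Nat.card_eq_fintype_card]
    exact hcard
  refine nonempty_iso_cycleGraph_five _ hW ?_ ?_
  · rintro ⟨a, hxa, hya⟩ ⟨b, hxb, hyb⟩ ⟨c, hxc, hyc⟩ hab hac hbc
    refine hniso (hdc.nonempty_iso_top_of_isNClique_pred (by norm_num) (K := {x, y, a, b, c}) ?_)
    have h3 : G.IsNClique 3 {a, b, c} := is3Clique_triple_iff.mpr ⟨hab, hac, hbc⟩
    have h4 : G.IsNClique 4 {y, a, b, c} := h3.insert (by
      simpa using ⟨hya, hyb, hyc⟩)
    exact h4.insert (by simpa using ⟨hxy, hxa, hxb, hxc⟩)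
  · rintro ⟨a, hxa, hya⟩ ⟨b, hxb, hyb⟩ ⟨c, hxc, hyc⟩ hab hac hbc nab nac
    by_contra nbc
    exact hcf x a b c hxa hxb hxc (fun h => hab (Subtype.ext h)) (fun h => hac (Subtype.ext h))
      (fun h => hbc (Subtype.ext h)) nab nac nbc
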